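/- arXiv:2210.16915 — 2 statements merged into one kernel-verified Lean document; each statement's English description precedes it below -/
import Mathlib

section
/- Let S, Aα, Aν be nonempty finite types, P a transition function, πν a fixed victim policy, rν : S → ℝ a reward, γ ∈ [0,1), and s₀ ∈ S. Let πα and π̃α be adversary policies, V a value function for (rν, Q[πα, πν]), Ṽ a value function for (rν, Q[π̃α, πν]), and H = max_{s ∈ S} |V s|. Then |Ṽ s₀ − V s₀| ≤ (γ · H / (1 − γ)) · max_{s ∈ S} Σ_{aα} |πα s aα − π̃α s aα|. (This is the Lipschitz-continuity claim following Lemma 2: the victim's expected return is Lipschitz in the adversary's policy with constant γH/(1−γ) in the maximal per-state L1 distance.) -/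
open Finset

theorem abs_sum_mul_le_sum_abs_mul {ι : Type*} [Fintype ι] (w f : ι → ℝ) {M : ℝ}
    (hf : ∀ i, |f i| ≤ M) : |∑ i, w i * f i| ≤ (∑ i, |w i|) * M :=
  calc |∑ i, w i * f i| ≤ ∑ i, |w i * f i| := abs_sum_le_sum_abs _ _
    _ ≤ ∑ i, |w i| * M := sum_le_sum fun i _ => by
        rw [abs_mul]
        exact mul_le_mul_of_nonneg_left (hf i) (abs_nonneg _)
    _ = (∑ i, |w i|) * M := (sum_mul _ _ _).symm

theorem abs_sum_mul_le_of_sum_eq_one {ι : Type*} [Fintype ι] (w f : ι → ℝ) {M : ℝ}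
    (hw : ∀ i, 0 ≤ w i) (hw1 : ∑ i, w i = 1) (hf : ∀ i, |f i| ≤ M) :
    |∑ i, w i * f i| ≤ M := by
  simpa only [abs_of_nonneg (hw _), hw1, one_mul] using abs_sum_mul_le_sum_abs_mul w f hf

/-- Integrating `f` against a signed mixture, with action weights `w`, of the transition
probabilities `p a b` averaged over `b` costs at most the total variation of `w`. -/
theorem abs_sum_mixture_mul_le {S A B : Type*} [Fintype S] [Fintype A] [Fintype B]
    (p : A → B → S → ℝ) (hp : ∀ a b s, 0 ≤ p a b s) (hp1 : ∀ a b, ∑ s, p a b s = 1)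
    (v : B → ℝ) (hv : ∀ b, 0 ≤ v b) (hv1 : ∑ b, v b = 1)
    (w : A → ℝ) (f : S → ℝ) {M : ℝ} (hf : ∀ s, |f s| ≤ M) :
    |∑ s, (∑ a, ∑ b, w a * v b * p a b s) * f s| ≤ (∑ a, |w a|) * M := by
  have h : ∑ s, (∑ a, ∑ b, w a * v b * p a b s) * f s =
      ∑ a, w a * ∑ b, v b * ∑ s, p a b s * f s := by
    simp only [sum_mul, mul_sum]
    rw [sum_comm]
    refine sum_congr rfl fun a _ => ?_
    rw [sum_comm]
    exact sum_congr rfl fun b _ => sum_congr rfl fun s _ => by ring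
  rw [h]
  exact abs_sum_mul_le_sum_abs_mul w _ fun a =>
    abs_sum_mul_le_of_sum_eq_one v _ hv hv1 fun b =>
      abs_sum_mul_le_of_sum_eq_one _ f (hp a b) (hp1 a b) hf

theorem victim_return_lipschitz_in_adversary_policy
    {S Aα Aν : Type*} [Fintype S] [Nonempty S] [Fintype Aα] [Nonempty Aα]
    [Fintype Aν] [Nonempty Aν]
    (P : S → Aα → Aν → S → ℝ)
    (hPnn : ∀ s aα aν s', 0 ≤ P s aα aν s')
    (hPsum : ∀ s aα aν, ∑ s', P s aα aν s' = 1)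
    (πν : S → Aν → ℝ)
    (hπνnn : ∀ s aν, 0 ≤ πν s aν) (hπνsum : ∀ s, ∑ aν, πν s aν = 1)
    (rν : S → ℝ) (γ : ℝ) (hγ0 : 0 ≤ γ) (hγ1 : γ < 1) (s₀ : S)
    (πα πα' : S → Aα → ℝ)
    (hπαnn : ∀ s aα, 0 ≤ πα s aα) (hπαsum : ∀ s, ∑ aα, πα s aα = 1)
    (hπα'nn : ∀ s aα, 0 ≤ πα' s aα) (hπα'sum : ∀ s, ∑ aα, πα' s aα = 1)
    (V V' : S → ℝ)
    (hV : ∀ s, V s = rν s +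
      γ * ∑ s', (∑ aα, ∑ aν, πα s aα * πν s aν * P s aα aν s') * V s')
    (hV' : ∀ s, V' s = rν s +
      γ * ∑ s', (∑ aα, ∑ aν, πα' s aα * πν s aν * P s aα aν s') * V' s')
    (H : ℝ) (hH : H = ⨆ s, |V s|) :
    |V' s₀ - V s₀| ≤
      γ * H / (1 - γ) * ⨆ s, ∑ aα, |πα s aα - πα' s aα| := by
  have hVH : ∀ s, |V s| ≤ H := fun s =>
    hH ▸ le_ciSup (f := fun s => |V s|) (Set.finite_range _).bddAbove s
  have hH0 : 0 ≤ H := (abs_nonneg _).trans (hVH s₀)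
  set L := ⨆ s, ∑ aα, |πα s aα - πα' s aα|
  have hLs : ∀ s, ∑ aα, |πα' s aα - πα s aα| ≤ L := fun s => by
    simp only [abs_sub_comm (πα' s _)]
    exact le_ciSup (f := fun s => ∑ aα, |πα s aα - πα' s aα|) (Set.finite_range _).bddAbove s
  obtain ⟨m, hm⟩ := Finite.exists_max fun s => |V' s - V s|
  have hdiff : V' m - V m =
      γ * (∑ s', (∑ aα, ∑ aν, πα' m aα * πν m aν * P m aα aν s') * (V' s' - V s') +
        ∑ s', (∑ aα, ∑ aν, (πα' m aα - πα m aα) * πν m aν * P m aα aν s') * V s') := by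
    rw [hV' m, hV m]
    simp only [sub_mul, mul_sub, sum_sub_distrib]
    ring
  have hQ := abs_sum_mixture_mul_le (P m) (hPnn m) (hPsum m) (πν m) (hπνnn m) (hπνsum m)
    (πα' m) (fun s => V' s - V s) hm
  simp only [abs_of_nonneg (hπα'nn _ _), hπα'sum, one_mul] at hQ
  have hD := abs_sum_mixture_mul_le (P m) (hPnn m) (hPsum m) (πν m) (hπνnn m) (hπνsum m)
    (fun a => πα' m a - πα m a) V hVH
  have hbound : |V' m - V m| ≤ γ * (|V' m - V m| + L * H) := by
    conv_lhs => rw [hdiff, abs_mul, abs_of_nonneg hγ0]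
    exact mul_le_mul_of_nonneg_left ((abs_add_le _ _).trans
      (add_le_add hQ (hD.trans (mul_le_mul_of_nonneg_right (hLs m) hH0)))) hγ0
  refine (hm s₀).trans ?_
  rw [div_mul_eq_mul_div, le_div_iff₀ (sub_pos.2 hγ1)]
  linarith
end

section
/- Let S, Aα, Aν be nonempty finite types, P a transition function, Δr : S → ℝ, γ ∈ [0,1), and s₀ ∈ S. For a victim policy πν define the optimal adversary value Λ(πν) = sSup { y : ℝ | ∃ an adversary policy πα and a value function V for (Δr, Q[πα, πν]) with y = V s₀ }. Let πν and πν₀ be victim policies with πν₀ s aν > 0 for all s, aν. Then |Λ(πν) − Λ(πν₀)| ≤ (γ · √(2 · ln 2) · max_{s ∈ S} |Δr s| / (1 − γ)²) · max_{s ∈ S} √(D_KL(πν s ‖ πν₀ s)). (This is the key per-policy estimate in the proof of Theorem 2: the optimal adversary return is perturbed by at most a √KL amount when the victim's policy changes.) -/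
open Finset

/-- Base-2 KL divergence between probability vectors on a finite type. -/
noncomputable def klDiv {A : Type*} [Fintype A] (p q : A → ℝ) : ℝ :=
  ∑ a, p a * Real.logb 2 (p a / q a)

/-- The optimal adversary value `Λ(πν)`: the supremum, over adversary policies `πα`,
of the value at `s₀` of the value function for `(Δr, Q[πα, πν])`. -/
noncomputable def optAdvValue {S Aα Aν : Type*} [Fintype S] [Fintype Aα] [Fintype Aν]
    (P : S → Aα → Aν → S → ℝ) (Δr : S → ℝ) (γ : ℝ) (s₀ : S)
    (πν : S → Aν → ℝ) : ℝ :=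
  sSup { y : ℝ | ∃ πα : S → Aα → ℝ,
    (∀ s aα, 0 ≤ πα s aα) ∧ (∀ s, ∑ aα, πα s aα = 1) ∧
    ∃ V : S → ℝ,
      (∀ s, V s = Δr s +
        γ * ∑ s', (∑ aα, ∑ aν, πα s aα * πν s aν * P s aα aν s') * V s') ∧
      y = V s₀ }

lemma div_le_log_of_pos {x : ℝ} (hx : 0 < x) :
    (x - 1) * (5 * x + 1) / (2 * x * (x + 2)) ≤ Real.log x := by
  let f : ℝ → ℝ := fun x => Real.log x - (x - 1) * (5 * x + 1) / (2 * x * (x + 2))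
  have hf : ∀ y, 0 < y → HasDerivAt f ((y - 1) ^ 3 / (y ^ 2 * (y + 2) ^ 2)) y := by
    intro y hy
    have hn : HasDerivAt (fun x : ℝ => (x - 1) * (5 * x + 1))
        (1 * (5 * y + 1) + (y - 1) * (5 * 1)) y :=
      ((hasDerivAt_id y).sub_const 1).mul (((hasDerivAt_id y).const_mul 5).add_const 1)
    have hd : HasDerivAt (fun x : ℝ => 2 * x * (x + 2))
        (2 * 1 * (y + 2) + 2 * y * 1) y :=
      ((hasDerivAt_id y).const_mul 2).mul ((hasDerivAt_id y).add_const 2)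
    have h := (Real.hasDerivAt_log hy.ne').sub (hn.div hd (by positivity))
    refine h.congr_deriv ?_
    field_simp
    ring
  have hf1 : f 1 = 0 := by simp [f]
  suffices 0 ≤ f x by simpa [f] using this
  rcases le_total x 1 with h1 | h1
  · have hanti : AntitoneOn f (Set.Ioc 0 1) := by
      refine antitoneOn_of_deriv_nonpos (convex_Ioc 0 1)
        (fun y hy => (hf y hy.1).continuousAt.continuousWithinAt)
        (fun y hy => ?_) (fun y hy => ?_)
      · rw [interior_Ioc] at hy
        exact (hf y hy.1).differentiableAt.differentiableWithinAt
      · rw [interior_Ioc] at hy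
        rw [(hf y hy.1).deriv]
        refine div_nonpos_of_nonpos_of_nonneg ?_ (by positivity)
        exact Odd.pow_nonpos (by decide) (by linarith [hy.2])
    rw [← hf1]
    exact hanti ⟨hx, h1⟩ ⟨one_pos, le_rfl⟩ h1
  · have hmono : MonotoneOn f (Set.Ici 1) := by
      refine monotoneOn_of_deriv_nonneg (convex_Ici 1)
        (fun y hy => (hf y (one_pos.trans_le hy)).continuousAt.continuousWithinAt)
        (fun y hy => ?_) (fun y hy => ?_)
      · rw [interior_Ici] at hy
        exact (hf y (one_pos.trans hy)).differentiableAt.differentiableWithinAt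
      · rw [interior_Ici] at hy
        rw [(hf y (one_pos.trans hy)).deriv]
        have : 0 ≤ y - 1 := by linarith [Set.mem_Ioi.mp hy]
        positivity
    rw [← hf1]
    exact hmono (Set.mem_Ici.mpr le_rfl) h1 h1

lemma sq_sub_div_le_mul_log_div {p q : ℝ} (hp : 0 ≤ p) (hq : 0 < q) :
    3 / 2 * ((p - q) ^ 2 / (p + 2 * q)) ≤ p * Real.log (p / q) - p + q := by
  rcases hp.eq_or_lt with rfl | hp
  · have : 3 / 2 * ((0 - q) ^ 2 / (0 + 2 * q)) = 3 / 4 * q := by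
      field_simp
      ring
    rw [this, zero_mul]
    linarith
  · have h := mul_le_mul_of_nonneg_left (div_le_log_of_pos (div_pos hp hq)) hp.le
    have e : p * ((p / q - 1) * (5 * (p / q) + 1) / (2 * (p / q) * (p / q + 2)))
        = 3 / 2 * ((p - q) ^ 2 / (p + 2 * q)) + p - q := by
      field_simp
      ring
    linarith

/-- Pinsker's inequality on a finite type. -/
lemma sq_sum_abs_sub_le_klDiv {A : Type*} [Fintype A] {p q : A → ℝ}
    (hp : ∀ a, 0 ≤ p a) (hp1 : ∑ a, p a = 1) (hq : ∀ a, 0 < q a) (hq1 : ∑ a, q a = 1) :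
    (∑ a, |p a - q a|) ^ 2 ≤ 2 * Real.log 2 * klDiv p q := by
  have hkl : Real.log 2 * klDiv p q = ∑ a, (p a * Real.log (p a / q a) - p a + q a) := by
    rw [sum_add_distrib, sum_sub_distrib, hp1, hq1, klDiv, mul_sum, sub_add_cancel]
    refine sum_congr rfl fun a _ => ?_
    have : Real.log 2 ≠ 0 := (Real.log_pos one_lt_two).ne'
    rw [Real.logb]
    field_simp
  have hw : ∀ a, 0 < p a + 2 * q a := fun a => by linarith [hp a, hq a]
  have h := sq_sum_div_le_sum_sq_div univ (fun a => |p a - q a|) (fun a _ => hw a)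
  have hs : ∑ a, (p a + 2 * q a) = 3 := by
    rw [sum_add_distrib, ← mul_sum, hp1, hq1]; norm_num
  simp only [sq_abs] at h
  rw [hs] at h
  have h2 : 3 / 2 * ∑ a, (p a - q a) ^ 2 / (p a + 2 * q a) ≤ Real.log 2 * klDiv p q := by
    rw [hkl, mul_sum]
    exact sum_le_sum fun a _ => sq_sub_div_le_mul_log_div (hp a) (hq a)
  linarith

lemma sum_abs_sub_le_sqrt_klDiv {A : Type*} [Fintype A] {p q : A → ℝ}
    (hp : ∀ a, 0 ≤ p a) (hp1 : ∑ a, p a = 1) (hq : ∀ a, 0 < q a) (hq1 : ∑ a, q a = 1) :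
    ∑ a, |p a - q a| ≤ Real.sqrt (2 * Real.log 2) * Real.sqrt (klDiv p q) := by
  rw [← Real.sqrt_mul (by positivity)]
  exact Real.le_sqrt_of_sq_le (sq_sum_abs_sub_le_klDiv hp hp1 hq hq1)

section ValueFunction

variable {S : Type*} [Fintype S]

lemma abs_sum_mul_le_of_sum_eq_one_s14 {w V : S → ℝ} (hw : ∀ s, 0 ≤ w s) (hw1 : ∑ s, w s = 1)
    {M : ℝ} (hV : ∀ s, |V s| ≤ M) : |∑ s, w s * V s| ≤ M :=
  calc |∑ s, w s * V s| ≤ ∑ s, |w s * V s| := abs_sum_le_sum_abs _ _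
    _ ≤ ∑ s, w s * M := sum_le_sum fun s _ => by
        rw [abs_mul, abs_of_nonneg (hw s)]
        exact mul_le_mul_of_nonneg_left (hV s) (hw s)
    _ = M := by rw [← sum_mul, hw1, one_mul]

lemma abs_le_of_bellman {Q : S → S → ℝ} (hQ : ∀ s s', 0 ≤ Q s s') (hQ1 : ∀ s, ∑ s', Q s s' = 1)
    {γ : ℝ} (hγ0 : 0 ≤ γ) (hγ1 : γ < 1) {r V : S → ℝ} {R : ℝ} (hr : ∀ s, |r s| ≤ R)
    (hV : ∀ s, V s = r s + γ * ∑ s', Q s s' * V s') (s : S) : |V s| ≤ R / (1 - γ) := by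
  obtain ⟨m, -, hm⟩ := exists_max_image univ (fun s => |V s|) ⟨s, mem_univ s⟩
  refine (hm s (mem_univ s)).trans ?_
  rw [le_div_iff₀ (by linarith)]
  have h1 := abs_sum_mul_le_of_sum_eq_one_s14 (hQ m) (hQ1 m) (fun s => hm s (mem_univ s))
  have h2 : |V m| ≤ |r m| + γ * |∑ s', Q m s' * V s'| := by
    conv_lhs => rw [hV m]
    refine (abs_add_le _ _).trans ?_
    rw [abs_mul, abs_of_nonneg hγ0]
  nlinarith [hr m, mul_le_mul_of_nonneg_left h1 hγ0]

lemma exists_bellman {Q : S → S → ℝ} (hQ : ∀ s s', 0 ≤ Q s s') (hQ1 : ∀ s, ∑ s', Q s s' = 1)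
    {γ : ℝ} (hγ0 : 0 ≤ γ) (hγ1 : γ < 1) (r : S → ℝ) :
    ∃ V : S → ℝ, ∀ s, V s = r s + γ * ∑ s', Q s s' * V s' := by
  let T : (S → ℝ) →ₗ[ℝ] (S → ℝ) := LinearMap.id - γ • Matrix.mulVecLin (Matrix.of Q)
  have hT : ∀ V s, T V s = V s - γ * ∑ s', Q s s' * V s' := fun V s => rfl
  have hinj : Function.Injective T := by
    rw [injective_iff_map_eq_zero]
    intro V hV
    funext s
    have h := abs_le_of_bellman hQ hQ1 hγ0 hγ1 (r := 0) (V := V) (R := 0) (by simp)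
      (fun s => by
        have := hT V s
        rw [hV] at this
        simp only [Pi.zero_apply] at this ⊢
        linarith) s
    simpa using h
  obtain ⟨V, hV⟩ := LinearMap.injective_iff_surjective.mp hinj r
  refine ⟨V, fun s => ?_⟩
  rw [← hV, hT]
  ring

lemma abs_sub_le_of_bellman {Q Q₀ : S → S → ℝ}
    (hQ : ∀ s s', 0 ≤ Q s s') (hQ1 : ∀ s, ∑ s', Q s s' = 1)
    (hQ₀ : ∀ s s', 0 ≤ Q₀ s s') (hQ₀1 : ∀ s, ∑ s', Q₀ s s' = 1)
    {γ : ℝ} (hγ0 : 0 ≤ γ) (hγ1 : γ < 1) {r V V₀ : S → ℝ} {R c : ℝ} (hr : ∀ s, |r s| ≤ R)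
    (hc : ∀ s, ∑ s', |Q s s' - Q₀ s s'| ≤ c)
    (hV : ∀ s, V s = r s + γ * ∑ s', Q s s' * V s')
    (hV₀ : ∀ s, V₀ s = r s + γ * ∑ s', Q₀ s s' * V₀ s') (s : S) :
    |V s - V₀ s| ≤ γ * (c * (R / (1 - γ))) / (1 - γ) := by
  have hb := abs_le_of_bellman hQ₀ hQ₀1 hγ0 hγ1 hr hV₀
  refine abs_le_of_bellman hQ hQ1 hγ0 hγ1 (V := fun s => V s - V₀ s)
    (r := fun s => γ * ∑ s', (Q s s' - Q₀ s s') * V₀ s') (fun s => ?_) (fun s => ?_) s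
  · rw [abs_mul, abs_of_nonneg hγ0]
    refine mul_le_mul_of_nonneg_left ?_ hγ0
    calc |∑ s', (Q s s' - Q₀ s s') * V₀ s'| ≤ ∑ s', |(Q s s' - Q₀ s s') * V₀ s'| :=
          abs_sum_le_sum_abs _ _
      _ ≤ ∑ s', |Q s s' - Q₀ s s'| * (R / (1 - γ)) := sum_le_sum fun s' _ => by
          rw [abs_mul]
          exact mul_le_mul_of_nonneg_left (hb s') (abs_nonneg _)
      _ ≤ c * (R / (1 - γ)) := by
          rw [← sum_mul]
          exact mul_le_mul_of_nonneg_right (hc s) ((abs_nonneg _).trans (hb s))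
  · rw [hV s, hV₀ s]
    simp only [sub_mul, mul_sub, sum_sub_distrib]
    ring

end ValueFunction

section InducedKernel

variable {S Aα Aν : Type*} [Fintype Aα] [Fintype Aν]
  {P : S → Aα → Aν → S → ℝ} {πα : S → Aα → ℝ} {πν πν₀ : S → Aν → ℝ}

lemma inducedKernel_nonneg (hPnn : ∀ s aα aν s', 0 ≤ P s aα aν s')
    (hα : ∀ s aα, 0 ≤ πα s aα) (hν : ∀ s aν, 0 ≤ πν s aν) (s s' : S) :
    0 ≤ ∑ aα, ∑ aν, πα s aα * πν s aν * P s aα aν s' :=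
  sum_nonneg fun aα _ => sum_nonneg fun aν _ =>
    mul_nonneg (mul_nonneg (hα s aα) (hν s aν)) (hPnn s aα aν s')

variable [Fintype S]

lemma sum_inducedKernel (hPsum : ∀ s aα aν, ∑ s', P s aα aν s' = 1) (s : S)
    (hα1 : ∑ aα, πα s aα = 1) (hν1 : ∑ aν, πν s aν = 1) :
    ∑ s', ∑ aα, ∑ aν, πα s aα * πν s aν * P s aα aν s' = 1 := by
  rw [sum_comm]
  have h : ∀ aα, ∑ s', ∑ aν, πα s aα * πν s aν * P s aα aν s' = πα s aα := fun aα => by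
    rw [sum_comm]
    simp only [← mul_sum, hPsum, mul_one, hν1]
  simp only [h, hα1]

lemma sum_abs_inducedKernel_sub_le (hPnn : ∀ s aα aν s', 0 ≤ P s aα aν s')
    (hPsum : ∀ s aα aν, ∑ s', P s aα aν s' = 1) (s : S)
    (hα : ∀ aα, 0 ≤ πα s aα) (hα1 : ∑ aα, πα s aα = 1) :
    ∑ s', |(∑ aα, ∑ aν, πα s aα * πν s aν * P s aα aν s') -
        ∑ aα, ∑ aν, πα s aα * πν₀ s aν * P s aα aν s'| ≤ ∑ aν, |πν s aν - πν₀ s aν| := by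
  calc _ ≤ ∑ s', ∑ aα, ∑ aν, πα s aα * |πν s aν - πν₀ s aν| * P s aα aν s' := by
        refine sum_le_sum fun s' _ => ?_
        simp only [← sum_sub_distrib]
        refine (abs_sum_le_sum_abs _ _).trans (sum_le_sum fun aα _ => ?_)
        refine (abs_sum_le_sum_abs _ _).trans (sum_le_sum fun aν _ => ?_)
        rw [← sub_mul, ← mul_sub, abs_mul, abs_mul, abs_of_nonneg (hα aα),
          abs_of_nonneg (hPnn s aα aν s')]
    _ = ∑ aν, |πν s aν - πν₀ s aν| := by
        rw [sum_comm]
        have h : ∀ aα, ∑ s', ∑ aν, πα s aα * |πν s aν - πν₀ s aν| * P s aα aν s' =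
            πα s aα * ∑ aν, |πν s aν - πν₀ s aν| := fun aα => by
          rw [sum_comm]
          simp only [← mul_sum, hPsum, mul_one]
        simp only [h]
        rw [← sum_mul, hα1, one_mul]

lemma optAdvValue_le_add [Nonempty Aα] (hPnn : ∀ s aα aν s', 0 ≤ P s aα aν s')
    (hPsum : ∀ s aα aν, ∑ s', P s aα aν s' = 1)
    {Δr : S → ℝ} {γ : ℝ} (hγ0 : 0 ≤ γ) (hγ1 : γ < 1) (s₀ : S)
    (hν : ∀ s aν, 0 ≤ πν s aν) (hν1 : ∀ s, ∑ aν, πν s aν = 1)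
    (hν₀ : ∀ s aν, 0 ≤ πν₀ s aν) (hν₀1 : ∀ s, ∑ aν, πν₀ s aν = 1)
    {R c : ℝ} (hR : ∀ s, |Δr s| ≤ R) (hc : ∀ s, ∑ aν, |πν s aν - πν₀ s aν| ≤ c) :
    optAdvValue P Δr γ s₀ πν ≤
      optAdvValue P Δr γ s₀ πν₀ + γ * (c * (R / (1 - γ))) / (1 - γ) := by
  apply csSup_le
  · obtain ⟨πα, hα, hα1⟩ : ∃ πα : S → Aα → ℝ, (∀ s aα, 0 ≤ πα s aα) ∧ ∀ s, ∑ aα, πα s aα = 1 :=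
      ⟨fun _ _ => (Fintype.card Aα : ℝ)⁻¹, fun _ _ => by positivity, fun _ => by simp⟩
    obtain ⟨V, hV⟩ := exists_bellman (inducedKernel_nonneg hPnn hα hν)
      (fun s => sum_inducedKernel hPsum s (hα1 s) (hν1 s)) hγ0 hγ1 Δr
    exact ⟨V s₀, πα, hα, hα1, V, hV, rfl⟩
  · rintro _ ⟨πα, hα, hα1, V, hV, rfl⟩
    have hK₀ := fun s => sum_inducedKernel (P := P) hPsum s (hα1 s) (hν₀1 s)
    obtain ⟨V₀, hV₀⟩ := exists_bellman (inducedKernel_nonneg hPnn hα hν₀) hK₀ hγ0 hγ1 Δr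
    have hdiff := abs_sub_le_of_bellman (inducedKernel_nonneg hPnn hα hν)
      (fun s => sum_inducedKernel hPsum s (hα1 s) (hν1 s))
      (inducedKernel_nonneg hPnn hα hν₀) hK₀ hγ0 hγ1 hR
      (fun s => (sum_abs_inducedKernel_sub_le hPnn hPsum s (hα s) (hα1 s)).trans (hc s))
      hV hV₀ s₀
    have hle : V₀ s₀ ≤ optAdvValue P Δr γ s₀ πν₀ := by
      refine le_csSup ⟨R / (1 - γ), ?_⟩ ⟨πα, hα, hα1, V₀, hV₀, rfl⟩
      rintro _ ⟨πα, hα, hα1, W, hW, rfl⟩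
      exact (le_abs_self _).trans (abs_le_of_bellman (inducedKernel_nonneg hPnn hα hν₀)
        (fun s => sum_inducedKernel hPsum s (hα1 s) (hν₀1 s)) hγ0 hγ1 hR hW s₀)
    linarith [le_abs_self (V s₀ - V₀ s₀)]

end InducedKernel

theorem optimal_adversary_value_KL_perturbation
    {S Aα Aν : Type*} [Fintype S] [Nonempty S] [Fintype Aα] [Nonempty Aα]
    [Fintype Aν] [Nonempty Aν]
    (P : S → Aα → Aν → S → ℝ)
    (hPnn : ∀ s aα aν s', 0 ≤ P s aα aν s')
    (hPsum : ∀ s aα aν, ∑ s', P s aα aν s' = 1)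
    (Δr : S → ℝ) (γ : ℝ) (hγ0 : 0 ≤ γ) (hγ1 : γ < 1) (s₀ : S)
    (πν πν₀ : S → Aν → ℝ)
    (hπνnn : ∀ s aν, 0 ≤ πν s aν) (hπνsum : ∀ s, ∑ aν, πν s aν = 1)
    (hπν₀pos : ∀ s aν, 0 < πν₀ s aν) (hπν₀sum : ∀ s, ∑ aν, πν₀ s aν = 1) :
    |optAdvValue P Δr γ s₀ πν - optAdvValue P Δr γ s₀ πν₀| ≤
      γ * Real.sqrt (2 * Real.log 2) * (⨆ s, |Δr s|) / (1 - γ) ^ 2 *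
        ⨆ s, Real.sqrt (klDiv (πν s) (πν₀ s)) := by
  have hR : ∀ s, |Δr s| ≤ ⨆ s, |Δr s| := le_ciSup (Set.finite_range _).bddAbove
  have hK : ∀ s, √(klDiv (πν s) (πν₀ s)) ≤ ⨆ s, √(klDiv (πν s) (πν₀ s)) :=
    le_ciSup (f := fun s => √(klDiv (πν s) (πν₀ s))) (Set.finite_range _).bddAbove
  have hc : ∀ s, ∑ aν, |πν s aν - πν₀ s aν| ≤
      √(2 * Real.log 2) * ⨆ s, √(klDiv (πν s) (πν₀ s)) := fun s =>
    (sum_abs_sub_le_sqrt_klDiv (hπνnn s) (hπνsum s) (hπν₀pos s) (hπν₀sum s)).trans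
      (mul_le_mul_of_nonneg_left (hK s) (Real.sqrt_nonneg _))
  have hc' : ∀ s, ∑ aν, |πν₀ s aν - πν s aν| ≤
      √(2 * Real.log 2) * ⨆ s, √(klDiv (πν s) (πν₀ s)) := fun s => by
    simpa only [abs_sub_comm] using hc s
  have hπν₀nn : ∀ s aν, 0 ≤ πν₀ s aν := fun s aν => (hπν₀pos s aν).le
  have h1 := optAdvValue_le_add hPnn hPsum hγ0 hγ1 s₀ hπνnn hπνsum hπν₀nn hπν₀sum hR hc
  have h2 := optAdvValue_le_add hPnn hPsum hγ0 hγ1 s₀ hπν₀nn hπν₀sum hπνnn hπνsum hR hc'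
  have e : γ * √(2 * Real.log 2) * (⨆ s, |Δr s|) / (1 - γ) ^ 2 *
        (⨆ s, √(klDiv (πν s) (πν₀ s))) =
      γ * (√(2 * Real.log 2) * (⨆ s, √(klDiv (πν s) (πν₀ s))) *
        ((⨆ s, |Δr s|) / (1 - γ))) / (1 - γ) := by
    have : 1 - γ ≠ 0 := by linarith
    field_simp
  rw [e, abs_le]
  constructor <;> linarith
end
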